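/- arXiv:2503.19918 — 4 statements merged into one kernel-verified Lean document; each statement's English description precedes it below -/
import Mathlib

section
/- Let K be a field, let (V_α)_{α∈ℤ₂} be the homogeneous components of a ℤ₂-graded K-vector space, and let W be a K-vector space. For n ∈ ℕ consider families F = (F_d)_{d : Fin n → ℤ₂} of maps F_d : (∏_{i} V_{d(i)}) → W, and for σ ∈ S_n define σ·F by (σ·F)_d(X) = ε(σ, d)·F_{d∘σ}(X∘σ), i.e. (σ·F)(X) = ε(σ, X)·F(σ⁻¹·X) on tuples of homogeneous elements. Then this is a group action of S_n: id·F = F, and (στ)·F = σ·(τ·F) for all σ, τ ∈ S_n. -/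
/-- For a permutation `σ` of `Fin n` and a degree pattern `d : Fin n → ZMod 2`,
`Kperm σ d` is the number of pairs `(i, j)` with `i < j`, `d (σ i) = 1`, `d (σ j) = 1`
and `σ j < σ i`. -/
def Kperm {n : ℕ} (σ : Equiv.Perm (Fin n)) (d : Fin n → ZMod 2) : ℕ :=
  (Finset.univ.filter (fun p : Fin n × Fin n =>
    p.1 < p.2 ∧ d (σ p.1) = 1 ∧ d (σ p.2) = 1 ∧ σ p.2 < σ p.1)).card

/-- `ε(σ, d) = sgn(σ) · (−1)^{K(σ, d)}` as an integer. -/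
def eps {n : ℕ} (σ : Equiv.Perm (Fin n)) (d : Fin n → ZMod 2) : ℤ :=
  (Equiv.Perm.sign σ : ℤ) * (-1) ^ (Kperm σ d)

/-- The action of `σ ∈ S_n` on families `F = (F_d)_d` of maps
`F_d : (∏ i, V_{d i}) → W`, given by `(σ·F)_d X = ε(σ, d) • F_{d ∘ σ} (X ∘ σ)`,
i.e. `(σ·F)(X) = ε(σ, X) · F(σ⁻¹·X)` on tuples of homogeneous elements. -/
def permAct {K : Type*} [Field K] {V W : Type*} [AddCommGroup V] [Module K V]
    [AddCommGroup W] [Module K W] (n : ℕ) (Vg : ZMod 2 → Submodule K V)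
    (σ : Equiv.Perm (Fin n))
    (F : (d : Fin n → ZMod 2) → ((i : Fin n) → Vg (d i)) → W) :
    (d : Fin n → ZMod 2) → ((i : Fin n) → Vg (d i)) → W :=
  fun d X => eps σ d • F (fun i => d (σ i)) (fun i => X (σ i))

/-- A product of a symmetric function over the pairs `i < j` is invariant under permuting the
indices. -/
theorem prod_lt_comp_perm_of_symm {α M : Type*} [Fintype α] [LinearOrder α] [CommMonoid M]
    (τ : Equiv.Perm α) (f : α → α → M) (hf : ∀ i j, i ≠ j → f i j = f j i) :
    ∏ p : α × α with p.1 < p.2, f (τ p.1) (τ p.2) = ∏ p : α × α with p.1 < p.2, f p.1 p.2 := by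
  let sortPair (ρ : Equiv.Perm α) (p : α × α) : α × α :=
    if ρ p.1 < ρ p.2 then (ρ p.1, ρ p.2) else (ρ p.2, ρ p.1)
  have mem (ρ : Equiv.Perm α) (p : α × α) (hp : p.1 < p.2) :
      (sortPair ρ p).1 < (sortPair ρ p).2 := by
    have := ρ.injective.ne hp.ne
    grind
  have inv (ρ : Equiv.Perm α) (p : α × α) (hp : p.1 < p.2) :
      sortPair ρ⁻¹ (sortPair ρ p) = p := by
    by_cases h : ρ p.1 < ρ p.2 <;> simp [sortPair, h, hp, hp.not_gt]
  refine Finset.prod_nbij' (sortPair τ) (sortPair τ⁻¹) ?_ ?_ ?_ ?_ ?_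
  · simpa using fun a b => mem τ (a, b)
  · simpa using fun a b => mem τ⁻¹ (a, b)
  · simpa using fun a b => inv τ (a, b)
  · simpa using fun a b => inv τ⁻¹ (a, b)
  · intro p hp
    have hne := τ.injective.ne (Finset.mem_filter.mp hp).2.ne
    by_cases h : τ p.1 < τ p.2 <;> simp [sortPair, h, hf _ _ hne]

/-- The sign contributed by the pair `(i, j)` to `(-1) ^ Kperm σ d`. -/
def oddInversionSign {n : ℕ} (σ : Equiv.Perm (Fin n)) (d : Fin n → ZMod 2) (i j : Fin n) : ℤ :=
  if d (σ i) = 1 ∧ d (σ j) = 1 ∧ (i < j ↔ σ j < σ i) then -1 else 1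

theorem neg_one_pow_Kperm {n : ℕ} (σ : Equiv.Perm (Fin n)) (d : Fin n → ZMod 2) :
    (-1 : ℤ) ^ Kperm σ d =
      ∏ p : Fin n × Fin n with p.1 < p.2, oddInversionSign σ d p.1 p.2 := by
  rw [Kperm, ← Finset.prod_const, ← Finset.filter_filter, Finset.prod_filter]
  refine Finset.prod_congr rfl fun p hp => ?_
  simp [oddInversionSign, (Finset.mem_filter.mp hp).2]

theorem oddInversionSign_symm {n : ℕ} (σ : Equiv.Perm (Fin n)) (d : Fin n → ZMod 2)
    (i j : Fin n) (h : i ≠ j) : oddInversionSign σ d i j = oddInversionSign σ d j i := by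
  have := σ.injective.ne h
  unfold oddInversionSign
  grind

theorem oddInversionSign_mul {n : ℕ} (σ τ : Equiv.Perm (Fin n)) (d : Fin n → ZMod 2)
    (i j : Fin n) (h : i ≠ j) :
    oddInversionSign (σ * τ) d i j =
      oddInversionSign σ d (τ i) (τ j) * oddInversionSign τ (fun k => d (σ k)) i j := by
  have h₁ := τ.injective.ne h
  have h₂ := σ.injective.ne h₁
  unfold oddInversionSign
  simp only [Equiv.Perm.mul_apply]
  grind

theorem eps_one {n : ℕ} (d : Fin n → ZMod 2) : eps 1 d = 1 := by
  have : Kperm 1 d = 0 := by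
    simp only [Kperm, Finset.card_eq_zero, Finset.filter_eq_empty_iff]
    exact fun p _ h => h.1.not_gt h.2.2.2
  simp [eps, this]

theorem eps_mul {n : ℕ} (σ τ : Equiv.Perm (Fin n)) (d : Fin n → ZMod 2) :
    eps (σ * τ) d = eps σ d * eps τ (fun i => d (σ i)) := by
  have key : (-1 : ℤ) ^ Kperm (σ * τ) d =
      (-1) ^ Kperm σ d * (-1) ^ Kperm τ (fun i => d (σ i)) := by
    simp only [neg_one_pow_Kperm]
    rw [← prod_lt_comp_perm_of_symm τ _ (oddInversionSign_symm σ d), ← Finset.prod_mul_distrib]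
    exact Finset.prod_congr rfl fun p hp =>
      oddInversionSign_mul σ τ d _ _ (Finset.mem_filter.mp hp).2.ne
  simp only [eps, key, map_mul, Units.val_mul]
  ring

/-- `F ↦ σ·F` is a group action of `S_n`: the identity permutation acts as the
identity, and `(στ)·F = σ·(τ·F)`. Here `(V_α)_α` are the homogeneous components
of a `ℤ₂`-graded vector space `V` and `W` is a vector space over the same field. -/
theorem permAct_is_group_action {K : Type*} [Field K] {V W : Type*}
    [AddCommGroup V] [Module K V] [AddCommGroup W] [Module K W]
    (n : ℕ) (Vg : ZMod 2 → Submodule K V) (hV : DirectSum.IsInternal Vg) :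
    (∀ F : (d : Fin n → ZMod 2) → ((i : Fin n) → Vg (d i)) → W,
        permAct n Vg 1 F = F) ∧
    (∀ (σ τ : Equiv.Perm (Fin n))
        (F : (d : Fin n → ZMod 2) → ((i : Fin n) → Vg (d i)) → W),
        permAct n Vg (σ * τ) F = permAct n Vg σ (permAct n Vg τ F)) := by
  refine ⟨fun F => ?_, fun σ τ F => ?_⟩
  · funext d X
    simp [permAct, eps_one]
  · funext d X
    simp [permAct, eps_mul, mul_smul]
end

section
/- Let (g, h, ρ) be a LieSupAct triple. A degree-0 linear map D : g → h is a crossed homomorphism with respect to ρ if and only if its graph G(D) = {x + D(x) : x ∈ g} is a Lie subalgebra of the semidirect product Lie superalgebra g ⋉_ρ h, i.e. G(D) is closed under the semidirect product bracket [x + u, y + v] = [x, y] + ρ(x)v − (−1)^{αβ}ρ(y)u + [u, v] (for homogeneous x ∈ g_α, u ∈ h_α, y ∈ g_β, v ∈ h_β). -/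
/-- A Lie superalgebra structure on a `K`-vector space `L`: a `ℤ₂`-grading
`L = L₀ ⊕ L₁` together with a bilinear bracket respecting the grading and
satisfying graded antisymmetry and the graded Jacobi identity on homogeneous
elements. -/
structure LieSuperAlgebra (K : Type*) [Field K] (L : Type*) [AddCommGroup L]
    [Module K L] where
  grading : ZMod 2 → Submodule K L
  isInternal : DirectSum.IsInternal grading
  bracket : L →ₗ[K] L →ₗ[K] L
  bracket_grading : ∀ (α β : ZMod 2), ∀ a ∈ grading α, ∀ b ∈ grading β,
    bracket a b ∈ grading (α + β)
  antisymm : ∀ (α β : ZMod 2), ∀ a ∈ grading α, ∀ b ∈ grading β,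
    bracket a b = -((-1 : K) ^ (α.val * β.val)) • bracket b a
  jacobi : ∀ (α β : ZMod 2), ∀ a ∈ grading α, ∀ b ∈ grading β, ∀ c : L,
    bracket a (bracket b c) =
      bracket (bracket a b) c + ((-1 : K) ^ (α.val * β.val)) • bracket b (bracket a c)

/-- A LieSupAct triple `(g, h, ρ)`: Lie superalgebras `g`, `h` together with an
action `ρ` of `g` on `h`, i.e. a degree-0 bilinear map such that each `ρ x`
(`x` homogeneous) is a superderivation of `h` and `ρ` is a morphism of Lie
superalgebras into `Der(h)`. -/
structure LieSupAct (K : Type*) [Field K]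
    (g : Type*) [AddCommGroup g] [Module K g]
    (h : Type*) [AddCommGroup h] [Module K h] where
  G : LieSuperAlgebra K g
  H : LieSuperAlgebra K h
  ρ : g →ₗ[K] h →ₗ[K] h
  ρ_grading : ∀ (α β : ZMod 2), ∀ x ∈ G.grading α, ∀ u ∈ H.grading β,
    ρ x u ∈ H.grading (α + β)
  ρ_der : ∀ (α β : ZMod 2), ∀ x ∈ G.grading α, ∀ u ∈ H.grading β, ∀ v : h,
    ρ x (H.bracket u v) =
      H.bracket (ρ x u) v + ((-1 : K) ^ (α.val * β.val)) • H.bracket u (ρ x v)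
  ρ_hom : ∀ (α β : ZMod 2), ∀ x ∈ G.grading α, ∀ y ∈ G.grading β, ∀ u : h,
    ρ (G.bracket x y) u = ρ x (ρ y u) - ((-1 : K) ^ (α.val * β.val)) • ρ y (ρ x u)

/-- A crossed homomorphism for a LieSupAct triple `(g, h, ρ)`: a degree-0 linear
map `D : g → h` with `D [x,y] = ρ(x)(D y) − (−1)^{αβ} ρ(y)(D x) + [D x, D y]`
for homogeneous `x ∈ g_α`, `y ∈ g_β`. -/
def IsCrossedHom {K : Type*} [Field K] {g : Type*} [AddCommGroup g] [Module K g]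
    {h : Type*} [AddCommGroup h] [Module K h]
    (T : LieSupAct K g h) (D : g →ₗ[K] h) : Prop :=
  (∀ (α : ZMod 2), ∀ x ∈ T.G.grading α, D x ∈ T.H.grading α) ∧
  ∀ (α β : ZMod 2), ∀ x ∈ T.G.grading α, ∀ y ∈ T.G.grading β,
    D (T.G.bracket x y) =
      T.ρ x (D y) - ((-1 : K) ^ (α.val * β.val)) • T.ρ y (D x)
        + T.H.bracket (D x) (D y)

namespace LieSuperAlgebra

/-- To prove an additive property of all pairs of elements of a Lie superalgebra, it suffices
to prove it for pairs of homogeneous elements. -/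
theorem homogeneous_induction₂ {K : Type*} [Field K] {L : Type*} [AddCommGroup L] [Module K L]
    (A : LieSuperAlgebra K L) {p : L → L → Prop}
    (zero_left : ∀ y, p 0 y) (zero_right : ∀ x, p x 0)
    (add_left : ∀ x x' y, p x y → p x' y → p (x + x') y)
    (add_right : ∀ x y y', p x y → p x y' → p x (y + y'))
    (homogeneous : ∀ α β, ∀ x ∈ A.grading α, ∀ y ∈ A.grading β, p x y) (x y : L) : p x y := by
  have mem_iSup (z : L) : z ∈ iSup A.grading := by
    rw [A.isInternal.submodule_iSup_eq_top]
    exact Submodule.mem_top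
  induction mem_iSup x using Submodule.iSup_induction' with
  | zero => exact zero_left y
  | add x x' _ _ hx hx' => exact add_left x x' y hx hx'
  | mem α x hx =>
    induction mem_iSup y using Submodule.iSup_induction' with
    | zero => exact zero_right x
    | add y y' _ _ hy hy' => exact add_right x y y' hy hy'
    | mem β y hy => exact homogeneous α β x hx y hy

end LieSuperAlgebra

/-- A degree-0 linear map `D : g → h` is a crossed homomorphism with respect to
`ρ` if and only if its graph `G(D) = {(x, D x) : x ∈ g}` is closed under the
bracket of the semidirect product Lie superalgebra `g ⋉_ρ h`, i.e. is a Lie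
subalgebra of `g ⋉_ρ h`.  Here `P` is the semidirect product structure: its
grading is `(g ⊕ h)_α = g_α ⊕ h_α` and its bracket is given on homogeneous
elements by `[x + u, y + v] = [x, y] + ρ(x)v − (−1)^{αβ} ρ(y)u + [u, v]`. -/
theorem isCrossedHom_iff_graph_lieSubalgebra
    {K : Type*} [Field K] {g : Type*} [AddCommGroup g] [Module K g]
    {h : Type*} [AddCommGroup h] [Module K h] (T : LieSupAct K g h)
    (P : LieSuperAlgebra K (g × h))
    (hgr : ∀ α : ZMod 2, P.grading α = (T.G.grading α).prod (T.H.grading α))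
    (hbr : ∀ (α β : ZMod 2), ∀ x ∈ T.G.grading α, ∀ u ∈ T.H.grading α,
      ∀ y ∈ T.G.grading β, ∀ v ∈ T.H.grading β,
        P.bracket (x, u) (y, v) =
          (T.G.bracket x y,
            T.ρ x v - ((-1 : K) ^ (α.val * β.val)) • T.ρ y u + T.H.bracket u v))
    (D : g →ₗ[K] h)
    (hD0 : ∀ (α : ZMod 2), ∀ x ∈ T.G.grading α, D x ∈ T.H.grading α) :
    IsCrossedHom T D ↔
      ∀ p ∈ LinearMap.graph D, ∀ q ∈ LinearMap.graph D,
        P.bracket p q ∈ LinearMap.graph D := by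
  constructor
  · rintro ⟨-, hD⟩ ⟨x, u⟩ hp ⟨y, v⟩ hq
    rw [LinearMap.mem_graph_iff] at hp hq
    obtain rfl : u = D x := hp
    obtain rfl : v = D y := hq
    induction x, y using T.G.homogeneous_induction₂ with
    | zero_left y => simp [Prod.mk_zero_zero]
    | zero_right x => simp [Prod.mk_zero_zero]
    | add_left x x' y hx hx' =>
      have hadd : ((x + x', D (x + x')) : g × h) = (x, D x) + (x', D x') := by simp
      rw [hadd, map_add, LinearMap.add_apply]
      exact add_mem hx hx'
    | add_right x y y' hy hy' =>
      have hadd : ((y + y', D (y + y')) : g × h) = (y, D y) + (y', D y') := by simp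
      rw [hadd, map_add]
      exact add_mem hy hy'
    | homogeneous α β x hx y hy =>
      rw [hbr α β x hx _ (hD0 α x hx) y hy _ (hD0 β y hy), LinearMap.mem_graph_iff]
      exact (hD α β x hx y hy).symm
  · refine fun hP => ⟨hD0, fun α β x hx y hy => ?_⟩
    have hxy := hP (x, D x) rfl (y, D y) rfl
    rw [hbr α β x hx _ (hD0 α x hx) y hy _ (hD0 β y hy), LinearMap.mem_graph_iff] at hxy
    exact hxy.symm
end

section
/- Let (g, h, ρ) be a LieSupAct triple, D : g → h a crossed homomorphism, and D₁ : g → h a degree-0 linear map. Let g[t]/(t²) and h[t]/(t²) denote the truncated polynomial extensions (elements a + b·t with t² = 0, grading inherited componentwise), with the brackets of g and h and the action ρ extended t-bilinearly, and set D_t = D + t·D₁ : g[t]/(t²) → h[t]/(t²). Then D_t is a linear deformation of D, i.e. D_t([x, y]) = ρ(x)D_t(y) − (−1)^{αβ}ρ(y)D_t(x) + [D_t(x), D_t(y)] for all homogeneous x ∈ g_α, y ∈ g_β, if and only if D₁ is a 1-cocycle, i.e. D₁([x, y]) = ρ(x)D₁(y) − (−1)^{αβ}ρ(y)D₁(x)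 + [D₁(x), D(y)] + [D(x), D₁(y)] for all homogeneous x ∈ g_α, y ∈ g_β. -/
/-- The `t`-bilinear extension of a bracket `B` to the truncated polynomial
extension `L[t]/(t²)`, realized on pairs `(a, b) ↔ a + b·t`. -/
def truncBrk {K : Type*} [Field K] {L : Type*} [AddCommGroup L] [Module K L]
    (B : L →ₗ[K] L →ₗ[K] L) : L × L → L × L → L × L :=
  fun p q => (B p.1 q.1, B p.1 q.2 + B p.2 q.1)

/-- The `t`-bilinear extension of the action `ρ` to the truncated polynomial
extensions `g[t]/(t²)` and `h[t]/(t²)`. -/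
def truncRho {K : Type*} [Field K] {g : Type*} [AddCommGroup g] [Module K g]
    {h : Type*} [AddCommGroup h] [Module K h]
    (ρ : g →ₗ[K] h →ₗ[K] h) : g × g → h × h → h × h :=
  fun p x => (ρ p.1 x.1, ρ p.1 x.2 + ρ p.2 x.1)

/-- The linear deformation `D_t = D + t·D₁ : g[t]/(t²) → h[t]/(t²)`. -/
def truncD {K : Type*} [Field K] {g : Type*} [AddCommGroup g] [Module K g]
    {h : Type*} [AddCommGroup h] [Module K h]
    (D D₁ : g →ₗ[K] h) : g × g → h × h :=
  fun p => (D p.1, D₁ p.1 + D p.2)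

/-- `D_t = D + t·D₁` is a linear deformation of the crossed homomorphism `D`,
i.e. `D_t [x, y] = ρ(x) D_t(y) − (−1)^{αβ} ρ(y) D_t(x) + [D_t x, D_t y]` holds
in `h[t]/(t²)` for all homogeneous `x, y ∈ g[t]/(t²)` (with the brackets and
the action extended `t`-bilinearly, `t² = 0`, and the grading inherited
componentwise), if and only if `D₁` is a `1`-cocycle:
`D₁ [x, y] = ρ(x) D₁(y) − (−1)^{αβ} ρ(y) D₁(x) + [D₁ x, D y] + [D x, D₁ y]`
for all homogeneous `x ∈ g_α`, `y ∈ g_β`. -/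
theorem linear_deformation_iff_one_cocycle
    {K : Type*} [Field K] {g : Type*} [AddCommGroup g] [Module K g]
    {h : Type*} [AddCommGroup h] [Module K h] (T : LieSupAct K g h)
    (D D₁ : g →ₗ[K] h) (hD : IsCrossedHom T D)
    (hD₁deg : ∀ (α : ZMod 2), ∀ x ∈ T.G.grading α, D₁ x ∈ T.H.grading α) :
    (∀ (α β : ZMod 2), ∀ a ∈ T.G.grading α, ∀ b ∈ T.G.grading α,
      ∀ c ∈ T.G.grading β, ∀ d ∈ T.G.grading β,
        truncD D D₁ (truncBrk T.G.bracket (a, b) (c, d)) =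
          truncRho T.ρ (a, b) (truncD D D₁ (c, d))
            - ((-1 : K) ^ (α.val * β.val)) • truncRho T.ρ (c, d) (truncD D D₁ (a, b))
            + truncBrk T.H.bracket (truncD D D₁ (a, b)) (truncD D D₁ (c, d))) ↔
    (∀ (α β : ZMod 2), ∀ x ∈ T.G.grading α, ∀ y ∈ T.G.grading β,
        D₁ (T.G.bracket x y) =
          T.ρ x (D₁ y) - ((-1 : K) ^ (α.val * β.val)) • T.ρ y (D₁ x)
            + T.H.bracket (D₁ x) (D y) + T.H.bracket (D x) (D₁ y)) := by
  constructor
  · intro H α β x hx y hy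
    have key := congrArg Prod.snd (H α β x hx 0 (zero_mem _) y hy 0 (zero_mem _))
    simp only [truncD, truncBrk, truncRho, Prod.snd_add, Prod.snd_sub, Prod.smul_snd,
      map_zero, LinearMap.zero_apply, add_zero] at key
    rw [key]
    abel
  · intro H α β a ha b hb c hc d hd
    ext
    · exact hD.2 α β a ha c hc
    · simp only [truncD, truncBrk, truncRho, Prod.snd_add, Prod.snd_sub, Prod.smul_snd,
        map_add, LinearMap.add_apply, smul_add]
      rw [H α β a ha c hc, hD.2 α β a ha d hd, hD.2 α β b hb c hc]
      abel
end

section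
/- Let (g, h, ρ) be a LieSupAct triple with brackets π on g and μ on h. Let π₁ : g × g → g and μ₁ : h × h → h be degree-0 graded-antisymmetric bilinear maps and ρ₁ : g → End(h) a degree-0 linear map. Then (π + tπ₁, μ + tμ₁, ρ + tρ₁) is a linear one-parameter deformation of (g, h, ρ) — i.e. (g[t]/(t²), π + tπ₁) and (h[t]/(t²), μ + tμ₁) are Lie superalgebras and ρ + tρ₁ : g[t]/(t²) → Der(h[t]/(t²)) is a Lie superalgebra homomorphism, all structures extended t-bilinearly with t² = 0 — if and only if the following hold for all homogeneous u ∈ g_α, v ∈ g_γ, w ∈ g, x ∈ h_β, y ∈ h: (i) π(u, π₁(v,w)) + π₁(u, π(v,w)) = π(π₁(u,v), w) + π₁(π(u,v), w) + (−1)^{αγ}(π(v, π₁(u,w)) + π₁(v, π(u,w))); (ii) μ(x', μ₁(y',z')) + μ₁(x', μ(y',z')) = μ(μ₁(x',y'), z') + μ₁(μ(x',y'), z') + (−1)^{β'γ'}(μ(y', μ₁(x',z')) + μ₁(y', μ(x',z'))) for homogeneous x' ∈ h_{β'}, y' ∈ h_{γ'}, z' ∈ h; (iii) ρ(π₁(u,v))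 + ρ₁(π(u,v)) = ρ(u)∘ρ₁(v) + ρ₁(u)∘ρ(v) − (−1)^{αγ}(ρ(v)∘ρ₁(u) + ρ₁(v)∘ρ(u)) as maps h → h; (iv) ρ₁(u)(μ(x,y)) + ρ(u)(μ₁(x,y)) = μ(ρ₁(u)x, y) + μ₁(ρ(u)x, y) + (−1)^{αβ}(μ(x, ρ₁(u)y) + μ₁(x, ρ(u)y)). -/
/-- The `t`-bilinear extension of `B + t·B₁` to the truncated polynomial
extension `L[t]/(t²)`, realized on pairs `(a, b) ↔ a + b·t`. -/
def truncBrk₁ {K : Type*} [Field K] {L : Type*} [AddCommGroup L] [Module K L]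
    (B B₁ : L →ₗ[K] L →ₗ[K] L) : L × L → L × L → L × L :=
  fun p q => (B p.1 q.1, B p.1 q.2 + B p.2 q.1 + B₁ p.1 q.1)

/-- The `t`-bilinear extension of `ρ + t·ρ₁` to the truncated polynomial
extensions `g[t]/(t²)` and `h[t]/(t²)`. -/
def truncRho₁ {K : Type*} [Field K] {g : Type*} [AddCommGroup g] [Module K g]
    {h : Type*} [AddCommGroup h] [Module K h]
    (ρ ρ₁ : g →ₗ[K] h →ₗ[K] h) : g × g → h × h → h × h :=
  fun p x => (ρ p.1 x.1, ρ p.1 x.2 + ρ p.2 x.1 + ρ₁ p.1 x.1)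

section Truncated

variable {K : Type*} [Field K] {g : Type*} [AddCommGroup g] [Module K g]
  {h : Type*} [AddCommGroup h] [Module K h]

/-- If `ρ` acts by `c`-twisted derivations of `μ` on `P × Q`, then so does `ρ + tρ₁` for
`μ + tμ₁` exactly when the `t`-linear part of the derivation rule holds. -/
theorem truncRho₁_der_iff (ρ ρ₁ : g →ₗ[K] h →ₗ[K] h) (μ μ₁ : h →ₗ[K] h →ₗ[K] h)
    (P : Submodule K g) (Q : Submodule K h) (c : K)
    (hder : ∀ u ∈ P, ∀ x ∈ Q, ∀ y, ρ u (μ x y) = μ (ρ u x) y + c • μ x (ρ u y)) :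
    (∀ (p : g × g) (x : h × h), p.1 ∈ P → p.2 ∈ P → x.1 ∈ Q → x.2 ∈ Q → ∀ y : h × h,
      truncRho₁ ρ ρ₁ p (truncBrk₁ μ μ₁ x y) =
        truncBrk₁ μ μ₁ (truncRho₁ ρ ρ₁ p x) y
          + c • truncBrk₁ μ μ₁ x (truncRho₁ ρ ρ₁ p y)) ↔
    ∀ u ∈ P, ∀ x ∈ Q, ∀ y,
      ρ₁ u (μ x y) + ρ u (μ₁ x y) =
        μ (ρ₁ u x) y + μ₁ (ρ u x) y + c • (μ x (ρ₁ u y) + μ₁ x (ρ u y)) := by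
  constructor
  · intro H u hu x hx y
    have := congrArg Prod.snd
      (H (u, 0) (x, 0) hu P.zero_mem hx Q.zero_mem (y, 0))
    simp only [truncRho₁, truncBrk₁, map_zero, LinearMap.zero_apply, zero_add, add_zero,
      Prod.snd_add, Prod.smul_snd] at this
    linear_combination (norm := module) this
  · rintro H ⟨p, p'⟩ ⟨x, x'⟩ hp hp' hx hx' ⟨y, y'⟩
    refine Prod.ext (hder p hp x hx y) ?_
    simp only [truncRho₁, truncBrk₁, map_add, LinearMap.add_apply, Prod.snd_add, Prod.smul_snd]
    linear_combination (norm := module) H p hp x hx y + hder p' hp' x hx y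
      + hder p hp x' hx' y + hder p hp x hx y'

/-- If `ρ` carries `π` on `P × Q` to `c`-twisted commutators, then `ρ + tρ₁` does so for
`π + tπ₁` exactly when the `t`-linear part of the commutator rule holds. -/
theorem truncRho₁_hom_iff (ρ ρ₁ : g →ₗ[K] h →ₗ[K] h) (π π₁ : g →ₗ[K] g →ₗ[K] g)
    (P Q : Submodule K g) (c : K)
    (hhom : ∀ u ∈ P, ∀ v ∈ Q, ∀ x, ρ (π u v) x = ρ u (ρ v x) - c • ρ v (ρ u x)) :
    (∀ p q : g × g, p.1 ∈ P → p.2 ∈ P → q.1 ∈ Q → q.2 ∈ Q → ∀ z : h × h,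
      truncRho₁ ρ ρ₁ (truncBrk₁ π π₁ p q) z =
        truncRho₁ ρ ρ₁ p (truncRho₁ ρ ρ₁ q z)
          - c • truncRho₁ ρ ρ₁ q (truncRho₁ ρ ρ₁ p z)) ↔
    ∀ u ∈ P, ∀ v ∈ Q, ∀ x,
      ρ (π₁ u v) x + ρ₁ (π u v) x =
        ρ u (ρ₁ v x) + ρ₁ u (ρ v x) - c • (ρ v (ρ₁ u x) + ρ₁ v (ρ u x)) := by
  constructor
  · intro H u hu v hv x
    have := congrArg Prod.snd
      (H (u, 0) (v, 0) hu P.zero_mem hv Q.zero_mem (x, 0))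
    simp only [truncRho₁, truncBrk₁, map_zero, LinearMap.zero_apply, zero_add, add_zero,
      Prod.snd_sub, Prod.smul_snd] at this
    linear_combination (norm := module) this
  · rintro H ⟨p, p'⟩ ⟨q, q'⟩ hp hp' hq hq' ⟨x, x'⟩
    refine Prod.ext (hhom p hp q hq x) ?_
    simp only [truncRho₁, truncBrk₁, map_add, LinearMap.add_apply, Prod.snd_sub, Prod.smul_snd]
    linear_combination (norm := module) H p hp q hq x + hhom p' hp' q hq x
      + hhom p hp q' hq' x + hhom p hp q hq x'

/-- The Jacobi identity for `B + tB₁`, given the one for `B`, amounts to its `t`-linear part. -/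
theorem truncBrk₁_jacobi_iff (B B₁ : h →ₗ[K] h →ₗ[K] h) (P Q : Submodule K h) (c : K)
    (hjac : ∀ a ∈ P, ∀ b ∈ Q, ∀ z, B a (B b z) = B (B a b) z + c • B b (B a z)) :
    (∀ p q : h × h, p.1 ∈ P → p.2 ∈ P → q.1 ∈ Q → q.2 ∈ Q → ∀ r : h × h,
      truncBrk₁ B B₁ p (truncBrk₁ B B₁ q r) =
        truncBrk₁ B B₁ (truncBrk₁ B B₁ p q) r
          + c • truncBrk₁ B B₁ q (truncBrk₁ B B₁ p r)) ↔
    ∀ a ∈ P, ∀ b ∈ Q, ∀ z,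
      B a (B₁ b z) + B₁ a (B b z) =
        B (B₁ a b) z + B₁ (B a b) z + c • (B b (B₁ a z) + B₁ b (B a z)) := by
  refine (truncRho₁_der_iff B B₁ B B₁ P Q c hjac).trans ?_
  simp only [add_comm (B _ (B₁ _ _)) (B₁ _ (B _ _))]

/-- `ρ + tρ₁` has degree `0` when `ρ` and `ρ₁` do. -/
theorem truncRho₁_mem {ρ ρ₁ : g →ₗ[K] h →ₗ[K] h} {P : Submodule K g} {Q R : Submodule K h}
    (hρ : ∀ u ∈ P, ∀ x ∈ Q, ρ u x ∈ R) (hρ₁ : ∀ u ∈ P, ∀ x ∈ Q, ρ₁ u x ∈ R)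
    {p : g × g} {x : h × h} (hp : p.1 ∈ P) (hp' : p.2 ∈ P) (hx : x.1 ∈ Q) (hx' : x.2 ∈ Q) :
    (truncRho₁ ρ ρ₁ p x).1 ∈ R ∧ (truncRho₁ ρ ρ₁ p x).2 ∈ R :=
  ⟨hρ _ hp _ hx, R.add_mem (R.add_mem (hρ _ hp _ hx') (hρ _ hp' _ hx)) (hρ₁ _ hp _ hx)⟩

/-- `B + tB₁` is `c`-twisted symmetric when `B` and `B₁` are. -/
theorem truncBrk₁_swap {B B₁ : h →ₗ[K] h →ₗ[K] h} {P Q : Submodule K h} {c : K}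
    (hB : ∀ a ∈ P, ∀ b ∈ Q, B a b = c • B b a) (hB₁ : ∀ a ∈ P, ∀ b ∈ Q, B₁ a b = c • B₁ b a)
    {p q : h × h} (hp : p.1 ∈ P) (hp' : p.2 ∈ P) (hq : q.1 ∈ Q) (hq' : q.2 ∈ Q) :
    truncBrk₁ B B₁ p q = c • truncBrk₁ B B₁ q p := by
  refine Prod.ext (hB _ hp _ hq) ?_
  simp only [truncBrk₁, Prod.smul_snd]
  linear_combination (norm := module) hB _ hp _ hq' + hB _ hp' _ hq + hB₁ _ hp _ hq

end Truncated

/-- `(π + tπ₁, μ + tμ₁, ρ + tρ₁)` is a linear one-parameter deformation of the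
LieSupAct triple `(g, h, ρ)` — that is, `(g[t]/(t²), π + tπ₁)` and
`(h[t]/(t²), μ + tμ₁)` are Lie superalgebras (grading inherited componentwise,
`t² = 0`) and `ρ + tρ₁` is an action of the former on the latter by
superderivations — if and only if `π₁ + ρ₁ + μ₁` is a `1`-cocycle, i.e.
conditions (i)–(iv) hold. -/
theorem linear_deformation_of_triple_iff_one_cocycle
    {K : Type*} [Field K] {g : Type*} [AddCommGroup g] [Module K g]
    {h : Type*} [AddCommGroup h] [Module K h] (T : LieSupAct K g h)
    (π₁ : g →ₗ[K] g →ₗ[K] g) (μ₁ : h →ₗ[K] h →ₗ[K] h) (ρ₁ : g →ₗ[K] h →ₗ[K] h)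
    (hπ₁grad : ∀ (α β : ZMod 2), ∀ u ∈ T.G.grading α, ∀ v ∈ T.G.grading β,
      π₁ u v ∈ T.G.grading (α + β))
    (hπ₁anti : ∀ (α β : ZMod 2), ∀ u ∈ T.G.grading α, ∀ v ∈ T.G.grading β,
      π₁ u v = -((-1 : K) ^ (α.val * β.val)) • π₁ v u)
    (hμ₁grad : ∀ (α β : ZMod 2), ∀ x ∈ T.H.grading α, ∀ y ∈ T.H.grading β,
      μ₁ x y ∈ T.H.grading (α + β))
    (hμ₁anti : ∀ (α β : ZMod 2), ∀ x ∈ T.H.grading α, ∀ y ∈ T.H.grading β,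
      μ₁ x y = -((-1 : K) ^ (α.val * β.val)) • μ₁ y x)
    (hρ₁grad : ∀ (α β : ZMod 2), ∀ u ∈ T.G.grading α, ∀ x ∈ T.H.grading β,
      ρ₁ u x ∈ T.H.grading (α + β)) :
    -- `(g[t]/(t²), π + tπ₁)` is a Lie superalgebra,
    ((∀ (α β : ZMod 2) (p q : g × g),
        p.1 ∈ T.G.grading α → p.2 ∈ T.G.grading α →
        q.1 ∈ T.G.grading β → q.2 ∈ T.G.grading β →
        (truncBrk₁ T.G.bracket π₁ p q).1 ∈ T.G.grading (α + β) ∧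
        (truncBrk₁ T.G.bracket π₁ p q).2 ∈ T.G.grading (α + β) ∧
        truncBrk₁ T.G.bracket π₁ p q =
          -((-1 : K) ^ (α.val * β.val)) • truncBrk₁ T.G.bracket π₁ q p) ∧
     (∀ (α β : ZMod 2) (p q : g × g),
        p.1 ∈ T.G.grading α → p.2 ∈ T.G.grading α →
        q.1 ∈ T.G.grading β → q.2 ∈ T.G.grading β → ∀ r : g × g,
        truncBrk₁ T.G.bracket π₁ p (truncBrk₁ T.G.bracket π₁ q r) =
          truncBrk₁ T.G.bracket π₁ (truncBrk₁ T.G.bracket π₁ p q) r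
            + ((-1 : K) ^ (α.val * β.val)) •
                truncBrk₁ T.G.bracket π₁ q (truncBrk₁ T.G.bracket π₁ p r)) ∧
     -- `(h[t]/(t²), μ + tμ₁)` is a Lie superalgebra,
     (∀ (α β : ZMod 2) (x y : h × h),
        x.1 ∈ T.H.grading α → x.2 ∈ T.H.grading α →
        y.1 ∈ T.H.grading β → y.2 ∈ T.H.grading β →
        (truncBrk₁ T.H.bracket μ₁ x y).1 ∈ T.H.grading (α + β) ∧
        (truncBrk₁ T.H.bracket μ₁ x y).2 ∈ T.H.grading (α + β) ∧
        truncBrk₁ T.H.bracket μ₁ x y =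
          -((-1 : K) ^ (α.val * β.val)) • truncBrk₁ T.H.bracket μ₁ y x) ∧
     (∀ (α β : ZMod 2) (x y : h × h),
        x.1 ∈ T.H.grading α → x.2 ∈ T.H.grading α →
        y.1 ∈ T.H.grading β → y.2 ∈ T.H.grading β → ∀ z : h × h,
        truncBrk₁ T.H.bracket μ₁ x (truncBrk₁ T.H.bracket μ₁ y z) =
          truncBrk₁ T.H.bracket μ₁ (truncBrk₁ T.H.bracket μ₁ x y) z
            + ((-1 : K) ^ (α.val * β.val)) •
                truncBrk₁ T.H.bracket μ₁ y (truncBrk₁ T.H.bracket μ₁ x z)) ∧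
     -- `ρ + tρ₁ : g[t]/(t²) → Der(h[t]/(t²))` is degree `0`, valued in
     -- superderivations, and a Lie superalgebra homomorphism:
     (∀ (α β : ZMod 2) (p : g × g) (x : h × h),
        p.1 ∈ T.G.grading α → p.2 ∈ T.G.grading α →
        x.1 ∈ T.H.grading β → x.2 ∈ T.H.grading β →
        (truncRho₁ T.ρ ρ₁ p x).1 ∈ T.H.grading (α + β) ∧
        (truncRho₁ T.ρ ρ₁ p x).2 ∈ T.H.grading (α + β)) ∧
     (∀ (α β : ZMod 2) (p : g × g) (x : h × h),
        p.1 ∈ T.G.grading α → p.2 ∈ T.G.grading α →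
        x.1 ∈ T.H.grading β → x.2 ∈ T.H.grading β → ∀ y : h × h,
        truncRho₁ T.ρ ρ₁ p (truncBrk₁ T.H.bracket μ₁ x y) =
          truncBrk₁ T.H.bracket μ₁ (truncRho₁ T.ρ ρ₁ p x) y
            + ((-1 : K) ^ (α.val * β.val)) •
                truncBrk₁ T.H.bracket μ₁ x (truncRho₁ T.ρ ρ₁ p y)) ∧
     (∀ (α γ : ZMod 2) (p q : g × g),
        p.1 ∈ T.G.grading α → p.2 ∈ T.G.grading α →
        q.1 ∈ T.G.grading γ → q.2 ∈ T.G.grading γ → ∀ z : h × h,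
        truncRho₁ T.ρ ρ₁ (truncBrk₁ T.G.bracket π₁ p q) z =
          truncRho₁ T.ρ ρ₁ p (truncRho₁ T.ρ ρ₁ q z)
            - ((-1 : K) ^ (α.val * γ.val)) •
                truncRho₁ T.ρ ρ₁ q (truncRho₁ T.ρ ρ₁ p z)))
    ↔
    -- (i)
    ((∀ (α γ : ZMod 2), ∀ u ∈ T.G.grading α, ∀ v ∈ T.G.grading γ, ∀ w : g,
        T.G.bracket u (π₁ v w) + π₁ u (T.G.bracket v w) =
          T.G.bracket (π₁ u v) w + π₁ (T.G.bracket u v) w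
            + ((-1 : K) ^ (α.val * γ.val)) •
                (T.G.bracket v (π₁ u w) + π₁ v (T.G.bracket u w))) ∧
     -- (ii)
     (∀ (β' γ' : ZMod 2), ∀ x' ∈ T.H.grading β', ∀ y' ∈ T.H.grading γ', ∀ z' : h,
        T.H.bracket x' (μ₁ y' z') + μ₁ x' (T.H.bracket y' z') =
          T.H.bracket (μ₁ x' y') z' + μ₁ (T.H.bracket x' y') z'
            + ((-1 : K) ^ (β'.val * γ'.val)) •
                (T.H.bracket y' (μ₁ x' z') + μ₁ y' (T.H.bracket x' z'))) ∧
     -- (iii)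
     (∀ (α γ : ZMod 2), ∀ u ∈ T.G.grading α, ∀ v ∈ T.G.grading γ, ∀ x : h,
        T.ρ (π₁ u v) x + ρ₁ (T.G.bracket u v) x =
          T.ρ u (ρ₁ v x) + ρ₁ u (T.ρ v x)
            - ((-1 : K) ^ (α.val * γ.val)) •
                (T.ρ v (ρ₁ u x) + ρ₁ v (T.ρ u x))) ∧
     -- (iv)
     (∀ (α β : ZMod 2), ∀ u ∈ T.G.grading α, ∀ x ∈ T.H.grading β, ∀ y : h,
        ρ₁ u (T.H.bracket x y) + T.ρ u (μ₁ x y) =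
          T.H.bracket (ρ₁ u x) y + μ₁ (T.ρ u x) y
            + ((-1 : K) ^ (α.val * β.val)) •
                (T.H.bracket x (ρ₁ u y) + μ₁ x (T.ρ u y)))) := by
  have jacG := fun α β => truncBrk₁_jacobi_iff T.G.bracket π₁ _ _ _ (T.G.jacobi α β)
  have jacH := fun α β => truncBrk₁_jacobi_iff T.H.bracket μ₁ _ _ _ (T.H.jacobi α β)
  have der := fun α β => truncRho₁_der_iff T.ρ ρ₁ T.H.bracket μ₁ _ _ _ (T.ρ_der α β)
  have hom := fun α β => truncRho₁_hom_iff T.ρ ρ₁ T.G.bracket π₁ _ _ _ (T.ρ_hom α β)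
  constructor
  · rintro ⟨-, hG, -, hH, -, hder, hhom⟩
    exact ⟨fun α β => (jacG α β).1 (hG α β), fun α β => (jacH α β).1 (hH α β),
      fun α β => (hom α β).1 (hhom α β), fun α β => (der α β).1 (hder α β)⟩
  · rintro ⟨hG, hH, hhom, hder⟩
    refine ⟨fun α β p q hp hp' hq hq' => ?_, fun α β => (jacG α β).2 (hG α β),
      fun α β x y hx hx' hy hy' => ?_, fun α β => (jacH α β).2 (hH α β),
      fun α β p x hp hp' hx hx' => ?_, fun α β => (der α β).2 (hder α β),
      fun α β => (hom α β).2 (hhom α β)⟩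
    · have hmem := truncRho₁_mem (T.G.bracket_grading α β) (hπ₁grad α β) hp hp' hq hq'
      exact ⟨hmem.1, hmem.2,
        truncBrk₁_swap (T.G.antisymm α β) (hπ₁anti α β) hp hp' hq hq'⟩
    · have hmem := truncRho₁_mem (T.H.bracket_grading α β) (hμ₁grad α β) hx hx' hy hy'
      exact ⟨hmem.1, hmem.2,
        truncBrk₁_swap (T.H.antisymm α β) (hμ₁anti α β) hx hx' hy hy'⟩
    · exact truncRho₁_mem (T.ρ_grading α β) (hρ₁grad α β) hp hp' hx hx'
end
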